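/- (Lyapunov function for the E-step ODE) Suppose the exponential family is minimal and let θ* : M° → ℝ^I be the inverse of the bijection ∇A, where M° is the interior of the set of realizable mean parameters. Define V(μ̂) = −l(θ*(μ̂); v) and the E-step vector field g†(μ̂) = μ̂*(θ*(μ̂); v) − μ̂ on M°. Then for every μ̂ ∈ M°: (a) F(μ̂) := ⟨∇V(μ̂), g†(μ̂)⟩ ≤ 0; (b) {μ̂ ∈ M° : F(μ̂) = 0} = {μ̂ ∈ M° : ∇V(μ̂) = 0}; and (c) the image under θ* of {μ̂ ∈ M° : F(μ̂) = 0} equals the set of stationary points {θ ∈ ℝ^I : ∂l(θ; v)/∂θ = 0} of the marginal log-likelihood. -/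

import Mathlib

/-- The log-partition function `A(θ) = log Σ_{x∈X} exp⟨θ, φ(x)⟩` over the full
configuration space `X = X^v × X^h`. -/
noncomputable def logPartition {Xv Xh I : Type*} [Fintype Xv] [Fintype Xh] [Fintype I]
    (φ : Xv × Xh → I → ℝ) (θ : I → ℝ) : ℝ :=
  Real.log (∑ x : Xv × Xh, Real.exp (∑ α : I, θ α * φ x α))

/-- The joint density `p_θ(v, h) = exp(⟨θ, φ(v, h)⟩ − A(θ))`. -/
noncomputable def jointDensity {Xv Xh I : Type*} [Fintype Xv] [Fintype Xh] [Fintype I]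
    (φ : Xv × Xh → I → ℝ) (θ : I → ℝ) (v : Xv) (h : Xh) : ℝ :=
  Real.exp ((∑ α : I, θ α * φ (v, h) α) - logPartition φ θ)

/-- The marginal density of a visible configuration `p_θ(v) = Σ_h p_θ(v, h)`. -/
noncomputable def visDensity {Xv Xh I : Type*} [Fintype Xv] [Fintype Xh] [Fintype I]
    (φ : Xv × Xh → I → ℝ) (θ : I → ℝ) (v : Xv) : ℝ :=
  ∑ h : Xh, jointDensity φ θ v h

/-- The conditional density `p_θ(h|v) = p_θ(v, h) / p_θ(v)`. -/
noncomputable def condDensity {Xv Xh I : Type*} [Fintype Xv] [Fintype Xh] [Fintype I]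
    (φ : Xv × Xh → I → ℝ) (θ : I → ℝ) (v : Xv) (h : Xh) : ℝ :=
  jointDensity φ θ v h / visDensity φ θ v

/-- The marginal log-likelihood `l(θ; v) = (1/N) Σ_{n=1}^N log p_θ(vⁿ)`. -/
noncomputable def margLoglik {Xv Xh I : Type*} [Fintype Xv] [Fintype Xh] [Fintype I]
    (φ : Xv × Xh → I → ℝ) (N : ℕ) (vdata : Fin N → Xv) (θ : I → ℝ) : ℝ :=
  (N : ℝ)⁻¹ * ∑ n : Fin N, Real.log (visDensity φ θ (vdata n))

/-- The expected empirical mean parameter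
`μ̂*(θ; v) = (1/N) Σ_n Σ_h φ(vⁿ, h) p_θ(h|vⁿ)`. -/
noncomputable def expEmpMean {Xv Xh I : Type*} [Fintype Xv] [Fintype Xh] [Fintype I]
    (φ : Xv × Xh → I → ℝ) (N : ℕ) (vdata : Fin N → Xv) (θ : I → ℝ) (α : I) : ℝ :=
  (N : ℝ)⁻¹ * ∑ n : Fin N, ∑ h : Xh, φ (vdata n, h) α * condDensity φ θ (vdata n) h

/-- The forward map `θ ↦ ∇A(θ) = (E_θ[φ_α(X)])_{α∈I}`. -/
noncomputable def forwardMap {Xv Xh I : Type*} [Fintype Xv] [Fintype Xh] [Fintype I]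
    (φ : Xv × Xh → I → ℝ) (θ : I → ℝ) : I → ℝ :=
  fun α => ∑ x : Xv × Xh, φ x α * jointDensity φ θ x.1 x.2

/-- The set `M_φ` of realizable mean parameters. -/
def meanParamSet {Xv Xh I : Type*} [Fintype Xv] [Fintype Xh] [Fintype I]
    (φ : Xv × Xh → I → ℝ) : Set (I → ℝ) :=
  {μ | ∃ q : Xv × Xh → ℝ, (∀ x, 0 ≤ q x) ∧ (∑ x : Xv × Xh, q x = 1) ∧
    ∀ α : I, μ α = ∑ x : Xv × Xh, φ x α * q x}

/-- Minimality: no nonzero `a ∈ ℝ^I` and constant `c` satisfy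
`⟨a, φ(x)⟩ = c` for all `x ∈ X`. -/
def MinimalFamily {Xv Xh I : Type*} [Fintype I] (φ : Xv × Xh → I → ℝ) : Prop :=
  ¬ ∃ a : I → ℝ, a ≠ 0 ∧ ∃ c : ℝ, ∀ x : Xv × Xh, ∑ α : I, a α * φ x α = c

/-- The candidate Lyapunov function `V(μ̂) = −l(θ*(μ̂); v)` for the E-step ODE. -/
noncomputable def lyapV {Xv Xh I : Type*} [Fintype Xv] [Fintype Xh] [Fintype I]
    (φ : Xv × Xh → I → ℝ) (N : ℕ) (vdata : Fin N → Xv)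
    (θstar : (I → ℝ) → (I → ℝ)) (μ : I → ℝ) : ℝ :=
  -(margLoglik φ N vdata (θstar μ))

/-- The E-step ODE vector field `g†(μ̂) = μ̂*(θ*(μ̂); v) − μ̂`. -/
noncomputable def eStepField {Xv Xh I : Type*} [Fintype Xv] [Fintype Xh] [Fintype I]
    (φ : Xv × Xh → I → ℝ) (N : ℕ) (vdata : Fin N → Xv)
    (θstar : (I → ℝ) → (I → ℝ)) (μ : I → ℝ) (α : I) : ℝ :=
  expEmpMean φ N vdata (θstar μ) α - μ α

/-- `F(μ̂) = ⟨∇V(μ̂), g†(μ̂)⟩`. -/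
noncomputable def lyapF {Xv Xh I : Type*} [Fintype Xv] [Fintype Xh] [Fintype I]
    [DecidableEq I]
    (φ : Xv × Xh → I → ℝ) (N : ℕ) (vdata : Fin N → Xv)
    (θstar : (I → ℝ) → (I → ℝ)) (μ : I → ℝ) : ℝ :=
  ∑ α : I, fderiv ℝ (lyapV φ N vdata θstar) μ (Pi.single α 1) *
    eStepField φ N vdata θstar μ α

/-- The linear functional `d ↦ Σ_α c_α d_α` on `ℝ^I`. -/
noncomputable def dotCLM {I : Type*} [Fintype I] (c : I → ℝ) : (I → ℝ) →L[ℝ] ℝ :=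
  ∑ α : I, c α • ContinuousLinearMap.proj (R := ℝ) (φ := fun _ : I => ℝ) α

theorem dotCLM_apply {I : Type*} [Fintype I] (c d : I → ℝ) :
    dotCLM c d = ∑ α : I, c α * d α := by
  simp [dotCLM]

theorem dotCLM_eq_zero_iff {I : Type*} [Fintype I] (c : I → ℝ) :
    dotCLM c = 0 ↔ c = 0 := by
  constructor
  · intro h
    have h₁ : ∑ α : I, c α * c α = 0 := by rw [← dotCLM_apply, h]; rfl
    have h₂ := (Finset.sum_eq_zero_iff_of_nonneg fun α _ => mul_self_nonneg (c α)).1 h₁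
    funext α
    exact mul_self_eq_zero.1 (h₂ α (Finset.mem_univ α))
  · rintro rfl
    simp [dotCLM]

section

variable {Xv Xh I : Type*} [Fintype Xv] [Fintype Xh] [Fintype I] (φ : Xv × Xh → I → ℝ)

theorem hasStrictFDerivAt_pairing (c θ : I → ℝ) :
    HasStrictFDerivAt (fun θ : I → ℝ => ∑ α : I, θ α * c α) (dotCLM c) θ := by
  have h : (fun θ : I → ℝ => ∑ α : I, θ α * c α) = dotCLM c := by
    funext θ
    simp [dotCLM_apply, mul_comm]
  rw [h]
  exact (dotCLM c).hasStrictFDerivAt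

theorem sum_exp_pos [Nonempty Xv] [Nonempty Xh] (θ : I → ℝ) :
    0 < ∑ x : Xv × Xh, Real.exp (∑ α : I, θ α * φ x α) :=
  Finset.sum_pos (fun _ _ => Real.exp_pos _) Finset.univ_nonempty

theorem jointDensity_eq_div [Nonempty Xv] [Nonempty Xh] (θ : I → ℝ) (v : Xv) (h : Xh) :
    jointDensity φ θ v h = Real.exp (∑ α : I, θ α * φ (v, h) α) /
      ∑ x : Xv × Xh, Real.exp (∑ α : I, θ α * φ x α) := by
  rw [jointDensity, Real.exp_sub, logPartition, Real.exp_log (sum_exp_pos φ θ)]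

theorem jointDensity_pos (θ : I → ℝ) (v : Xv) (h : Xh) : 0 < jointDensity φ θ v h :=
  Real.exp_pos _

theorem sum_jointDensity [Nonempty Xv] [Nonempty Xh] (θ : I → ℝ) :
    ∑ x : Xv × Xh, jointDensity φ θ x.1 x.2 = 1 := by
  simp only [jointDensity_eq_div, Prod.mk.eta, ← Finset.sum_div]
  exact div_self (sum_exp_pos φ θ).ne'

theorem visDensity_pos [Nonempty Xh] (θ : I → ℝ) (v : Xv) : 0 < visDensity φ θ v :=
  Finset.sum_pos (fun _ _ => jointDensity_pos φ θ v _) Finset.univ_nonempty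

theorem sum_condDensity [Nonempty Xh] (θ : I → ℝ) (v : Xv) :
    ∑ h : Xh, condDensity φ θ v h = 1 := by
  simp only [condDensity, ← Finset.sum_div]
  exact div_self (visDensity_pos φ θ v).ne'

theorem hasStrictFDerivAt_logPartition [Nonempty Xv] [Nonempty Xh] (θ : I → ℝ) :
    HasStrictFDerivAt (logPartition φ) (dotCLM (forwardMap φ θ)) θ := by
  have h := (HasStrictFDerivAt.fun_sum (u := (Finset.univ : Finset (Xv × Xh))) fun x _ =>
    (hasStrictFDerivAt_pairing (φ x) θ).exp).log (sum_exp_pos φ θ).ne'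
  refine h.congr_fderiv ?_
  ext d
  simp only [smul_apply, sum_apply, dotCLM_apply,
    forwardMap, jointDensity_eq_div, smul_eq_mul, Finset.mul_sum, Finset.sum_mul]
  rw [Finset.sum_comm]
  refine Finset.sum_congr rfl fun α _ => Finset.sum_congr rfl fun x _ => ?_
  ring

theorem hasStrictFDerivAt_jointDensity [Nonempty Xv] [Nonempty Xh] (θ : I → ℝ)
    (v : Xv) (h : Xh) :
    HasStrictFDerivAt (fun θ => jointDensity φ θ v h)
      (jointDensity φ θ v h • (dotCLM (φ (v, h)) - dotCLM (forwardMap φ θ))) θ :=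
  ((hasStrictFDerivAt_pairing (φ (v, h)) θ).sub (hasStrictFDerivAt_logPartition φ θ)).exp

theorem hasStrictFDerivAt_margLoglik [Nonempty Xv] [Nonempty Xh] {N : ℕ} (hN : 0 < N)
    (vdata : Fin N → Xv) (θ : I → ℝ) :
    HasStrictFDerivAt (margLoglik φ N vdata)
      (dotCLM (expEmpMean φ N vdata θ - forwardMap φ θ)) θ := by
  have h := (HasStrictFDerivAt.fun_sum (u := (Finset.univ : Finset (Fin N))) fun n _ =>
    (HasStrictFDerivAt.fun_sum (u := (Finset.univ : Finset Xh)) fun k _ =>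
      hasStrictFDerivAt_jointDensity φ θ (vdata n) k).log
        (visDensity_pos φ θ (vdata n)).ne').const_mul (N : ℝ)⁻¹
  refine h.congr_fderiv ?_
  ext d
  have hterm : ∀ n : Fin N,
      (∑ k : Xh, jointDensity φ θ (vdata n) k)⁻¹ * ∑ k : Xh, jointDensity φ θ (vdata n) k *
        (dotCLM (φ (vdata n, k)) d - dotCLM (forwardMap φ θ) d) =
      ∑ k : Xh, dotCLM (φ (vdata n, k)) d * condDensity φ θ (vdata n) k -
        dotCLM (forwardMap φ θ) d := by
    intro n
    have h₁ : ∀ k : Xh, condDensity φ θ (vdata n) k =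
      (∑ k : Xh, jointDensity φ θ (vdata n) k)⁻¹ * jointDensity φ θ (vdata n) k :=
      fun k => div_eq_inv_mul _ _
    calc _ = ∑ k : Xh, condDensity φ θ (vdata n) k *
            (dotCLM (φ (vdata n, k)) d - dotCLM (forwardMap φ θ) d) := by
          rw [Finset.mul_sum]
          exact Finset.sum_congr rfl fun k _ => by rw [h₁, mul_assoc]
      _ = _ := by
          simp only [mul_sub, Finset.sum_sub_distrib, ← Finset.sum_mul, sum_condDensity, one_mul]
          simp only [mul_comm]
  have hN' : (N : ℝ) ≠ 0 := by positivity
  simp only [smul_apply, sum_apply,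
    sub_apply, smul_eq_mul, hterm]
  simp only [Finset.sum_sub_distrib, Finset.sum_const, Finset.card_univ, Fintype.card_fin, nsmul_eq_mul, mul_sub,
    inv_mul_cancel_left₀ hN']
  have hsub : dotCLM (expEmpMean φ N vdata θ - forwardMap φ θ) d =
      dotCLM (expEmpMean φ N vdata θ) d - dotCLM (forwardMap φ θ) d := by
    simp [dotCLM_apply, sub_mul]
  rw [hsub]
  congr 1
  simp only [dotCLM_apply, expEmpMean, Finset.mul_sum, Finset.sum_mul]
  refine Eq.symm (Finset.sum_comm.trans (Finset.sum_congr rfl fun n _ =>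
    Finset.sum_comm.trans (Finset.sum_congr rfl fun k _ =>
      Finset.sum_congr rfl fun α _ => ?_)))
  ring

/-- The covariance operator of `φ` under `p_θ`. -/
noncomputable def covCLM (θ : I → ℝ) : (I → ℝ) →L[ℝ] (I → ℝ) :=
  ContinuousLinearMap.pi fun α => ∑ x : Xv × Xh, φ x α • jointDensity φ θ x.1 x.2 •
    (dotCLM (φ x) - dotCLM (forwardMap φ θ))

theorem hasStrictFDerivAt_forwardMap [Nonempty Xv] [Nonempty Xh] (θ : I → ℝ) :
    HasStrictFDerivAt (forwardMap φ) (covCLM φ θ) θ :=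
  hasStrictFDerivAt_pi.2 fun α => HasStrictFDerivAt.fun_sum fun x _ =>
    (hasStrictFDerivAt_jointDensity φ θ x.1 x.2).const_mul (φ x α)

/-- The quadratic form of the covariance operator is the variance of `⟨d, φ⟩`. -/
theorem sum_covCLM_mul [Nonempty Xv] [Nonempty Xh] (θ d : I → ℝ) :
    ∑ α : I, covCLM φ θ d α * d α = ∑ x : Xv × Xh, jointDensity φ θ x.1 x.2 *
      (dotCLM (φ x) d - dotCLM (forwardMap φ θ) d) ^ 2 := by
  set m := dotCLM (forwardMap φ θ) d with hm
  have hmean : ∑ x : Xv × Xh, jointDensity φ θ x.1 x.2 * dotCLM (φ x) d = m := by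
    simp only [hm, dotCLM_apply, forwardMap, Finset.mul_sum, Finset.sum_mul]
    rw [Finset.sum_comm]
    exact Finset.sum_congr rfl fun α _ => Finset.sum_congr rfl fun x _ => by ring
  have hcenter : ∑ x : Xv × Xh, jointDensity φ θ x.1 x.2 * (dotCLM (φ x) d - m) = 0 := by
    simp only [mul_sub, Finset.sum_sub_distrib, hmean, ← Finset.sum_mul, sum_jointDensity,
      one_mul, sub_self]
  have hleft : ∑ α : I, covCLM φ θ d α * d α =
      ∑ x : Xv × Xh, jointDensity φ θ x.1 x.2 * (dotCLM (φ x) d - m) * dotCLM (φ x) d := by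
    simp only [covCLM, ContinuousLinearMap.pi_apply, sum_apply,
      smul_apply, sub_apply, smul_eq_mul, ← hm,
      Finset.sum_mul]
    rw [Finset.sum_comm]
    refine Finset.sum_congr rfl fun x _ => ?_
    rw [dotCLM_apply (φ x) d, Finset.mul_sum]
    exact Finset.sum_congr rfl fun α _ => by ring
  have hsplit : ∀ x : Xv × Xh, jointDensity φ θ x.1 x.2 * (dotCLM (φ x) d - m) ^ 2 =
      jointDensity φ θ x.1 x.2 * (dotCLM (φ x) d - m) * dotCLM (φ x) d -
        jointDensity φ θ x.1 x.2 * (dotCLM (φ x) d - m) * m := fun x => by ring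
  simp only [hleft, hsplit, Finset.sum_sub_distrib, ← Finset.sum_mul, hcenter, zero_mul, sub_zero]

theorem sum_covCLM_mul_nonneg [Nonempty Xv] [Nonempty Xh] (θ d : I → ℝ) :
    0 ≤ ∑ α : I, covCLM φ θ d α * d α := by
  rw [sum_covCLM_mul]
  exact Finset.sum_nonneg fun x _ =>
    mul_nonneg (jointDensity_pos φ θ x.1 x.2).le (sq_nonneg _)

variable {φ} in
theorem MinimalFamily.eq_zero_of_sum_covCLM_mul [Nonempty Xv] [Nonempty Xh]
    (hmin : MinimalFamily φ) {θ d : I → ℝ} (h : ∑ α : I, covCLM φ θ d α * d α = 0) :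
    d = 0 := by
  rw [sum_covCLM_mul, Finset.sum_eq_zero_iff_of_nonneg fun x _ =>
    mul_nonneg (jointDensity_pos φ θ x.1 x.2).le (sq_nonneg _)] at h
  by_contra hd
  refine hmin ⟨d, hd, dotCLM (forwardMap φ θ) d, fun x => ?_⟩
  have hx := (mul_eq_zero.1 (h x (Finset.mem_univ x))).resolve_left
    (jointDensity_pos φ θ x.1 x.2).ne'
  rw [← sub_eq_zero.1 (pow_eq_zero_iff two_ne_zero |>.1 hx), dotCLM_apply]
  simp only [mul_comm]

variable {φ} in
theorem MinimalFamily.covCLM_injective [Nonempty Xv] [Nonempty Xh]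
    (hmin : MinimalFamily φ) (θ : I → ℝ) : Function.Injective (covCLM φ θ) :=
  (injective_iff_map_eq_zero _).2 fun d hd =>
    hmin.eq_zero_of_sum_covCLM_mul (θ := θ) (by simp [hd])

theorem forwardMap_mem_meanParamSet [Nonempty Xv] [Nonempty Xh] (θ : I → ℝ) :
    forwardMap φ θ ∈ meanParamSet φ :=
  ⟨fun x => jointDensity φ θ x.1 x.2, fun x => (jointDensity_pos φ θ x.1 x.2).le,
    sum_jointDensity φ θ, fun _ => rfl⟩

variable {φ} in
theorem MinimalFamily.forwardMap_mem_interior [Nonempty Xv] [Nonempty Xh]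
    (hmin : MinimalFamily φ) (θ : I → ℝ) :
    forwardMap φ θ ∈ interior (meanParamSet φ) := by
  have hsurj : Function.Surjective (covCLM φ θ) :=
    LinearMap.injective_iff_surjective (f := (covCLM φ θ).toLinearMap).1
      (hmin.covCLM_injective θ)
  have hmap := (hasStrictFDerivAt_forwardMap φ θ).map_nhds_eq_of_surj
    (LinearMap.range_eq_top.2 hsurj)
  rw [mem_interior_iff_mem_nhds, ← hmap]
  exact Filter.mem_map.2 (Filter.univ_mem' fun θ' => forwardMap_mem_meanParamSet φ θ')

end


/-- (Lyapunov function for the E-step ODE) Assume minimality, and let `θ*` be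
the `C¹` inverse on `M°` of the bijection `∇A : ℝ^I → M°`. With
`V(μ̂) = −l(θ*(μ̂); v)` and `g†(μ̂) = μ̂*(θ*(μ̂); v) − μ̂`, for every `μ̂ ∈ M°`:
(a) `F(μ̂) = ⟨∇V(μ̂), g†(μ̂)⟩ ≤ 0`; (b) `{F = 0} = {∇V = 0}` within `M°`; and
(c) `θ*({μ̂ ∈ M° : F(μ̂) = 0})` is exactly the set of stationary points of the
marginal log-likelihood. -/
theorem lyapunov_E_step
    {Xv Xh I : Type*} [Fintype Xv] [Fintype Xh] [Nonempty Xv] [Nonempty Xh]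
    [Fintype I] [DecidableEq I]
    (φ : Xv × Xh → I → ℝ) (N : ℕ) (hN : 0 < N) (vdata : Fin N → Xv)
    (hmin : MinimalFamily φ)
    (θstar : (I → ℝ) → (I → ℝ))
    (hinv₁ : ∀ θ : I → ℝ, θstar (forwardMap φ θ) = θ)
    (hinv₂ : ∀ μ ∈ interior (meanParamSet φ), forwardMap φ (θstar μ) = μ)
    (hC1 : ContDiffOn ℝ 1 θstar (interior (meanParamSet φ))) :
    (∀ μ ∈ interior (meanParamSet φ), lyapF φ N vdata θstar μ ≤ 0) ∧
    ({μ ∈ interior (meanParamSet φ) | lyapF φ N vdata θstar μ = 0} =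
      {μ ∈ interior (meanParamSet φ) | fderiv ℝ (lyapV φ N vdata θstar) μ = 0}) ∧
    (θstar '' {μ ∈ interior (meanParamSet φ) | lyapF φ N vdata θstar μ = 0} =
      {θ : I → ℝ | fderiv ℝ (margLoglik φ N vdata) θ = 0}) := by
  have hV : ∀ μ ∈ interior (meanParamSet φ), ∃ T : (I → ℝ) →L[ℝ] (I → ℝ),
      (∀ d, covCLM φ (θstar μ) (T d) = d) ∧
      fderiv ℝ (lyapV φ N vdata θstar) μ =
        -((dotCLM (eStepField φ N vdata θstar μ)).comp T) := by
    intro μ hμ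
    have hnhds : interior (meanParamSet φ) ∈ nhds μ := isOpen_interior.mem_nhds hμ
    have hθ : HasFDerivAt θstar (fderiv ℝ θstar μ) μ :=
      ((hC1.contDiffAt hnhds).differentiableAt one_ne_zero).hasFDerivAt
    refine ⟨fderiv ℝ θstar μ, fun d => ?_, ?_⟩
    · have hcomp := (hasStrictFDerivAt_forwardMap φ (θstar μ)).hasFDerivAt.comp μ hθ
      have hid : HasFDerivAt (forwardMap φ ∘ θstar) (ContinuousLinearMap.id ℝ (I → ℝ)) μ :=
        (hasFDerivAt_id μ).congr_of_eventuallyEq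
          (Filter.eventually_of_mem hnhds fun ν hν => hinv₂ ν hν)
      exact DFunLike.congr_fun (hcomp.unique hid) d
    · have hl := ((hasStrictFDerivAt_margLoglik φ hN vdata (θstar μ)).hasFDerivAt.comp μ hθ).neg
      rw [hinv₂ μ hμ] at hl
      exact hl.fderiv
  have hF : ∀ μ, lyapF φ N vdata θstar μ =
      fderiv ℝ (lyapV φ N vdata θstar) μ (eStepField φ N vdata θstar μ) := by
    intro μ
    have h := LinearMap.pi_apply_eq_sum_univ
      (fderiv ℝ (lyapV φ N vdata θstar) μ).toLinearMap (eStepField φ N vdata θstar μ)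
    refine Eq.trans ?_ h.symm
    refine Finset.sum_congr rfl fun α _ => ?_
    rw [smul_eq_mul, mul_comm]
    have hsingle : (Pi.single α 1 : I → ℝ) = fun β => if α = β then 1 else 0 := by
      funext β
      simp [Pi.single_apply, eq_comm]
    rw [hsingle]
    rfl
  have hquad : ∀ μ ∈ interior (meanParamSet φ), ∃ w : I → ℝ,
      covCLM φ (θstar μ) w = eStepField φ N vdata θstar μ ∧
      lyapF φ N vdata θstar μ = -∑ α : I, covCLM φ (θstar μ) w α * w α := by
    intro μ hμ
    obtain ⟨T, hT, hfd⟩ := hV μ hμ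
    refine ⟨T (eStepField φ N vdata θstar μ), hT _, ?_⟩
    rw [hF, hfd, hT, ← dotCLM_apply]
    rfl
  have hzero : ∀ μ ∈ interior (meanParamSet φ), lyapF φ N vdata θstar μ = 0 →
      eStepField φ N vdata θstar μ = 0 := by
    intro μ hμ h
    obtain ⟨w, hw, hFw⟩ := hquad μ hμ
    have hw₀ := hmin.eq_zero_of_sum_covCLM_mul (neg_eq_zero.1 (hFw.symm.trans h))
    rw [← hw, hw₀, map_zero]
  refine ⟨fun μ hμ => ?_, ?_, ?_⟩
  · obtain ⟨w, -, hFw⟩ := hquad μ hμ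
    rw [hFw]
    exact neg_nonpos.2 (sum_covCLM_mul_nonneg φ _ w)
  · ext μ
    refine and_congr_right fun hμ => ⟨fun h => ?_, fun h => ?_⟩
    · obtain ⟨T, -, hfd⟩ := hV μ hμ
      rw [hfd, hzero μ hμ h, (dotCLM_eq_zero_iff _).2 rfl]
      simp
    · rw [hF, h]
      rfl
  · have hgrad : ∀ μ ∈ interior (meanParamSet φ),
        fderiv ℝ (margLoglik φ N vdata) (θstar μ) =
          dotCLM (eStepField φ N vdata θstar μ) := by
      intro μ hμ
      have h := (hasStrictFDerivAt_margLoglik φ hN vdata (θstar μ)).hasFDerivAt.fderiv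
      rw [hinv₂ μ hμ] at h
      exact h
    ext θ
    constructor
    · rintro ⟨μ, ⟨hμ, h⟩, rfl⟩
      exact (hgrad μ hμ).trans ((dotCLM_eq_zero_iff _).2 (hzero μ hμ h))
    · intro h
      have hμ := hmin.forwardMap_mem_interior θ
      refine ⟨forwardMap φ θ, ⟨hμ, ?_⟩, hinv₁ θ⟩
      have hg := hgrad _ hμ
      rw [hinv₁ θ, show fderiv ℝ (margLoglik φ N vdata) θ = 0 from h] at hg
      rw [hF, (dotCLM_eq_zero_iff _).1 hg.symm, map_zero]
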